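/- Let R be a commutative ring and A an R-algebra of finite expansion such that every prime of A is quasi-isolated in its fibre over Spec R (i.e., the morphism Spec A → Spec R is quasi-profinite). Then the morphism of schemes Spec A → Spec R' induced by the inclusion of the integral closure R' of R in A into A is an open immersion. -/

import Mathlib

open TensorProduct

universe u

/-- An `R`-algebra `A` is of *finite expansion* if it is integral over a finitely
generated subalgebra, i.e. there is a finite set of quasi-generators. -/
def Algebra.FiniteExpansion (R A : Type u) [CommRing R] [CommRing A] [Algebra R A] : Prop :=
  ∃ s : Finset A, Algebra.IsIntegral (Algebra.adjoin R (s : Set A)) A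

/-- The fibre ring `A ⊗_R κ(p)` of `Spec A → Spec R` over a prime `p` of `R`, where
`κ(p) = Frac(R ⧸ p)` is the residue field at `p`. -/
abbrev fiberRing (R A : Type u) [CommRing R] [CommRing A] [Algebra R A] (p : Ideal R) :
    Type _ :=
  A ⊗[R] FractionRing (R ⧸ p)

/-- A prime `q` of `A` is *quasi-isolated in its fibre* over `Spec R` if the connected
component of the corresponding point of the fibre `Spec (A ⊗_R κ(p))`, where `p = q ∩ R`,
is a singleton. -/
def QuasiIsolatedInFiber (R : Type u) {A : Type u} [CommRing R] [CommRing A] [Algebra R A]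
    (q : PrimeSpectrum A) : Prop :=
  ∀ q' : PrimeSpectrum (fiberRing R A (q.asIdeal.comap (algebraMap R A))),
    PrimeSpectrum.comap Algebra.TensorProduct.includeLeftRingHom q' = q →
      connectedComponent q' = {q'}

/-- A prime which is quasi-isolated in its fibre has no strict specializations in this fibre. -/
theorem QuasiIsolatedInFiber.eq_of_le {R A : Type u} [CommRing R] [CommRing A] [Algebra R A]
    {q q' : PrimeSpectrum A} (hq : QuasiIsolatedInFiber R q) (hle : q ≤ q')
    (hqq' : PrimeSpectrum.comap (algebraMap R A) q' = PrimeSpectrum.comap (algebraMap R A) q) :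
    q = q' := by
  set p := PrimeSpectrum.comap (algebraMap R A) q
  let e : p.asIdeal.ResidueField ≃ₐ[R] FractionRing (R ⧸ p.asIdeal) :=
    (FractionRing.algEquiv (R ⧸ p.asIdeal) p.asIdeal.ResidueField).symm.restrictScalars R
  let E : p.asIdeal.Fiber A ≃ₐ[R] fiberRing R A p.asIdeal :=
    (Algebra.TensorProduct.congr e AlgEquiv.refl).trans (Algebra.TensorProduct.comm R _ A)
  let lift (x : PrimeSpectrum.comap (algebraMap R A) ⁻¹' {p}) :
      PrimeSpectrum (fiberRing R A p.asIdeal) :=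
    PrimeSpectrum.comap E.symm.toRingEquiv.toRingHom (PrimeSpectrum.preimageOrderIsoFiber R A p x)
  have hlift (x) : PrimeSpectrum.comap Algebra.TensorProduct.includeLeftRingHom (lift x) = x.1 := by
    rw [← PrimeSpectrum.comap_comp_apply]
    have : E.symm.toRingEquiv.toRingHom.comp Algebra.TensorProduct.includeLeftRingHom =
        (Algebra.TensorProduct.includeRight : A →ₐ[R] p.asIdeal.Fiber A).toRingHom := by
      ext a
      simp [E]
    rw [this]
    exact congr_arg Subtype.val ((PrimeSpectrum.preimageOrderIsoFiber R A p).symm_apply_apply x)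
  have hspec : lift ⟨q, rfl⟩ ⤳ lift ⟨q', hqq'⟩ := by
    rw [← PrimeSpectrum.le_iff_specializes]
    exact Ideal.comap_mono ((PrimeSpectrum.preimageOrderIsoFiber R A p).monotone hle)
  have hmem : lift ⟨q', hqq'⟩ ∈ connectedComponent (lift ⟨q, rfl⟩) :=
    isPreconnected_singleton.closure.subset_connectedComponent
      (subset_closure rfl) hspec.mem_closure
  have heq : lift ⟨q', hqq'⟩ = lift ⟨q, rfl⟩ := (hq (lift ⟨q, rfl⟩) (hlift _)).subset hmem
  exact (hlift ⟨q, rfl⟩).symm.trans ((congr_arg _ heq.symm).trans (hlift ⟨q', hqq'⟩))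

/-- A finite type algebra without strict specializations in its fibres is quasi-finite. -/
theorem Algebra.QuasiFinite.of_forall_eq_of_le {R S : Type*} [CommRing R] [CommRing S]
    [Algebra R S] [Algebra.FiniteType R S]
    (h : ∀ q q' : PrimeSpectrum S, q ≤ q' →
      PrimeSpectrum.comap (algebraMap R S) q' = PrimeSpectrum.comap (algebraMap R S) q → q = q') :
    Algebra.QuasiFinite R S where
  finite_fiber P hP := by
    rw [Module.finite_iff_krullDimLE_zero, Ring.krullDimLE_zero_iff]
    intro I hI
    obtain ⟨M, hM, hIM⟩ := Ideal.exists_le_maximal I hI.ne_top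
    let e := PrimeSpectrum.preimageOrderIsoFiber R S ⟨P, hP⟩
    have hle : e.symm ⟨I, hI⟩ ≤ e.symm ⟨M, hM.isPrime⟩ := e.symm.monotone hIM
    have heq : e.symm ⟨I, hI⟩ = e.symm ⟨M, hM.isPrime⟩ :=
      Subtype.ext (h _ _ hle ((e.symm ⟨M, hM.isPrime⟩).2.trans (e.symm ⟨I, hI⟩).2.symm))
    have : I = M := congr_arg PrimeSpectrum.asIdeal (e.symm.injective heq)
    exact this ▸ hM

/-- Zariski's main property ascends along integral extensions. -/
theorem Algebra.ZariskisMainProperty.of_isIntegral_of_under {R S A : Type*} [CommRing R]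
    [CommRing S] [CommRing A] [Algebra R S] [Algebra S A] [Algebra R A] [IsScalarTower R S A]
    [Algebra.IsIntegral S A] {q : Ideal A} (h : Algebra.ZariskisMainProperty R (q.under S)) :
    Algebra.ZariskisMainProperty R q := by
  rw [zariskisMainProperty_iff] at h
  rw [zariskisMainProperty_iff']
  obtain ⟨r, hr, hri, H⟩ := h
  refine ⟨algebraMap S A r, hr, fun x ↦ ?_⟩
  nontriviality A
  obtain ⟨f, hf, hfx⟩ := Algebra.IsIntegral.isIntegral (R := S) x
  choose m hm using fun i ↦ H (f.coeff i)
  let M := f.support.sup m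
  refine ⟨M, ?_⟩
  have hroot : Polynomial.eval₂ (algebraMap S A) (algebraMap S A (r ^ M) * x)
      (f.scaleRoots (r ^ M)) = 0 := Polynomial.scaleRoots_eval₂_eq_zero _ hfx
  have hmonic : (f.scaleRoots (r ^ M)).Monic := Polynomial.monic_scaleRoots_iff (r ^ M) |>.mpr hf
  have hdeg : f.natDegree ≠ 0 := fun h0 ↦ by
    simp [hf.natDegree_eq_zero.mp h0] at hfx
  have : Nontrivial S := (algebraMap S A).domain_nontrivial
  rw [← map_pow]
  refine IsIntegral.of_aeval_monic_of_isIntegral_coeff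
    (p := (f.scaleRoots (r ^ M)).map (algebraMap S A)) (hmonic.map _) ?_ ?_ fun i ↦ ?_
  · rwa [hmonic.natDegree_map, Polynomial.natDegree_scaleRoots]
  · rw [Polynomial.eval_map, hroot]
    exact isIntegral_zero
  · rw [Polynomial.coeff_map]
    refine IsIntegral.algebraMap ?_
    rw [Polynomial.coeff_scaleRoots]
    by_cases hi : i ∈ f.support
    · obtain hlt | hge := lt_or_ge i f.natDegree
      · obtain ⟨k, hk⟩ := Nat.exists_eq_add_of_lt hlt
        obtain ⟨l, hl⟩ := Nat.exists_eq_add_of_le (Finset.le_sup hi : m i ≤ M)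
        have hsub : f.natDegree - i = k + 1 := by omega
        rw [hsub, show f.coeff i * (r ^ M) ^ (k + 1) =
          r ^ (M * k + l) * (r ^ m i * f.coeff i) by rw [show M = m i + l from hl]; ring]
        exact (hri.pow _).mul (hm i)
      · have : i = f.natDegree := le_antisymm (Polynomial.le_natDegree_of_mem_supp i hi) hge
        subst this
        simpa [hf.coeff_natDegree] using isIntegral_one
    · rw [Polynomial.notMem_support_iff.mp hi, zero_mul]
      exact isIntegral_zero

open AlgebraicGeometry CategoryTheory in
/-- If localizing `f` at elements `r i` of the source whose images generate the unit ideal of the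
target gives isomorphisms, then `Spec f` is an open immersion. -/
theorem isOpenImmersion_SpecMap_of_bijective_awayMap {R S : CommRingCat.{u}} (f : R ⟶ S)
    (h : ∀ q : PrimeSpectrum S, ∃ r : R, f.hom r ∉ q.asIdeal ∧
      Function.Bijective (Localization.awayMap f.hom r)) :
    IsOpenImmersion (Spec.map f) := by
  choose r hr hbij using h
  let V (q : PrimeSpectrum S) : (Spec R).Opens := PrimeSpectrum.basicOpen (r q)
  have hiso : IsIso (Spec.map f ∣_ ⨆ q, V q) := by
    let 𝒰 := Scheme.Opens.iSupOpenCover V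
    refine (IsZariskiLocalAtTarget.iff_of_openCover
      (P := MorphismProperty.isomorphisms _) 𝒰).mpr fun x ↦ ?_
    refine (MorphismProperty.arrow_mk_iso_iff
      (MorphismProperty.isomorphisms _)
      ((morphismRestrictRestrict ..).symm ≪≫ morphismRestrictOpensRange ..)).mp ?_
    have hV : Scheme.Opens.ι _ ''ᵁ (𝒰.f x).opensRange = V x := by
      simp only [Scheme.Opens.iSupOpenCover, 𝒰, ← Scheme.Hom.opensRange_comp, Scheme.homOfLE_ι,
        Scheme.Opens.opensRange_ι]
    rw [hV]
    refine (MorphismProperty.arrow_mk_iso_iff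
      (MorphismProperty.isomorphisms _)
      (SpecMapRestrictBasicOpenIso f (r x))).mpr ?_
    have : IsIso (CommRingCat.ofHom (Localization.awayMap f.hom (r x))) :=
      (ConcreteCategory.isIso_iff_bijective _).mpr (hbij x)
    exact inferInstanceAs (IsIso (Spec.map _))
  have htop : Spec.map f ⁻¹ᵁ (⨆ q, V q) = ⊤ := by
    refine top_le_iff.mp fun q _ ↦ ?_
    exact TopologicalSpace.Opens.mem_iSup.mpr ⟨q, hr q⟩
  have : IsIso (Spec.map f ⁻¹ᵁ (⨆ q, V q)).ι := by
    rw [htop]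
    exact (Scheme.topIso _).isIso_hom
  have hfac : Spec.map f = inv (Spec.map f ⁻¹ᵁ (⨆ q, V q)).ι ≫
      (Spec.map f ∣_ ⨆ q, V q) ≫ (⨆ q, V q).ι := by
    rw [IsIso.eq_inv_comp, morphismRestrict_ι]
  rw [hfac]
  infer_instance

open AlgebraicGeometry in
/-- Zariski's main theorem, quasi-profinite case: if `A` is an `R`-algebra of finite expansion
all of whose primes are quasi-isolated in their fibres over `Spec R` (i.e. `Spec A → Spec R`
is quasi-profinite), then `Spec A → Spec R'` is an open immersion, where `R'` is the integral
closure of `R` in `A`. -/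
theorem isOpenImmersion_spec_map_of_quasiProfinite (R A : Type u) [CommRing R] [CommRing A]
    [Algebra R A] (hA : Algebra.FiniteExpansion R A)
    (hq : ∀ q : PrimeSpectrum A, QuasiIsolatedInFiber R q) :
    IsOpenImmersion (Spec.map (CommRingCat.ofHom (algebraMap (integralClosure R A) A))) := by
  obtain ⟨s, hs⟩ := hA
  let S := Algebra.adjoin R (s : Set A)
  have : Algebra.FiniteType R S := (Subalgebra.fg_iff_finiteType S).mp ⟨s, rfl⟩
  have : Algebra.QuasiFinite R S := by
    refine .of_forall_eq_of_le fun q q' hle hqq' ↦ ?_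
    obtain ⟨Q, -, hQ, hQq⟩ := Ideal.exists_ideal_over_prime_of_isIntegral (S := A) q.asIdeal ⊥
      (by simp [← RingHom.ker_eq_comap_bot, (RingHom.injective_iff_ker_eq_bot _).mp
        (FaithfulSMul.algebraMap_injective S A)])
    obtain ⟨Q', hQQ', hQ', hQq'⟩ := Ideal.exists_ideal_over_prime_of_isIntegral_of_isPrime
      (S := A) q'.asIdeal Q (hQq.trans_le hle)
    have hcomap : PrimeSpectrum.comap (algebraMap S A) ⟨Q, hQ⟩ = q := PrimeSpectrum.ext hQq
    have hcomap' : PrimeSpectrum.comap (algebraMap S A) ⟨Q', hQ'⟩ = q' := PrimeSpectrum.ext hQq'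
    have : (⟨Q, hQ⟩ : PrimeSpectrum A) = ⟨Q', hQ'⟩ := (hq ⟨Q, hQ⟩).eq_of_le hQQ' (by
      rw [IsScalarTower.algebraMap_eq R S A, PrimeSpectrum.comap_comp_apply,
        PrimeSpectrum.comap_comp_apply, hcomap, hcomap', hqq'])
    rw [← hcomap, ← hcomap', this]
  refine isOpenImmersion_SpecMap_of_bijective_awayMap _ fun q ↦ ?_
  exact Algebra.ZariskisMainProperty.of_isIntegral_of_under (S := S)
    (Algebra.ZariskisMainProperty.of_finiteType (q.asIdeal.under S))
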